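/- Let U_1,...,U_n be independent Haar-random N×N unitary matrices. Then E[ sup_{∑|λ_i|² ≤ 1} ‖∑_{i=1}^n λ_i U_i‖_{M_N} ] ≤ 32π(1 + √(n/(4N))), where ‖·‖_{M_N} is the operator norm. -/

import Mathlib

open scoped BigOperators Matrix
open MeasureTheory

/-- The operator norm (`ℓ²→ℓ²`) of a complex matrix. -/
noncomputable def matOpNorm {ι : Type*} [Fintype ι] [DecidableEq ι] (A : Matrix ι ι ℂ) : ℝ :=
  ‖Matrix.toEuclideanCLM (𝕜 := ℂ) A‖

/-- The closed unit ball of a finite-dimensional real normed space has a `1/2`-net of cardinality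
at most `5 ^ dim`. -/
lemma exists_half_net (E : Type*) [NormedAddCommGroup E] [NormedSpace ℝ E]
    [FiniteDimensional ℝ E] :
    ∃ s : Finset E, s.card ≤ 5 ^ Module.finrank ℝ E ∧ (∀ c ∈ s, ‖c‖ ≤ 1) ∧
      ∀ x : E, ‖x‖ ≤ 1 → ∃ c ∈ s, ‖x - c‖ ≤ 1 / 2 := by
  classical
  obtain ⟨s, hcard, hs2, hsep⟩ : Besicovitch.multiplicity E ∈
      {N | ∃ s : Finset E, s.card = N ∧ (∀ c ∈ s, ‖c‖ ≤ 2) ∧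
        ∀ c ∈ s, ∀ d ∈ s, c ≠ d → 1 ≤ ‖c - d‖} := by
    refine Nat.sSup_mem ⟨0, ∅, by simp⟩ ⟨5 ^ Module.finrank ℝ E, ?_⟩
    rintro _ ⟨s, rfl, h⟩
    exact Besicovitch.card_le_of_separated s h.1 h.2
  have half : ∀ v : E, ‖(1 / 2 : ℝ) • v‖ = ‖v‖ / 2 := fun v => by
    rw [norm_smul, Real.norm_of_nonneg (by norm_num)]; ring
  refine ⟨s.image fun c => (1 / 2 : ℝ) • c, ?_, ?_, fun x hx => ?_⟩
  · exact Finset.card_image_le.trans (hcard.le.trans Besicovitch.multiplicity_le)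
  · simp only [Finset.mem_image, forall_exists_index, and_imp, forall_apply_eq_imp_iff₂, half]
    intro c hc
    linarith [hs2 c hc]
  · by_contra! hfar
    have hfar' : ∀ c ∈ s, 1 ≤ ‖(2 : ℝ) • x - c‖ := fun c hc => by
      have h := hfar _ (Finset.mem_image_of_mem _ hc)
      have e : x - (1 / 2 : ℝ) • c = (1 / 2 : ℝ) • ((2 : ℝ) • x - c) := by
        rw [smul_sub, smul_smul]; norm_num
      rw [e, half] at h
      linarith
    have hx2 : (2 : ℝ) • x ∉ s := fun h => by
      have := hfar' _ h
      norm_num at this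
    have hle := Besicovitch.card_le_multiplicity (s := insert ((2 : ℝ) • x) s) (by
        intro c hc
        rcases Finset.mem_insert.1 hc with rfl | hc
        · rw [norm_smul, Real.norm_of_nonneg (by norm_num)]; linarith
        · exact hs2 c hc) (by
        intro c hc d hd hcd
        rcases Finset.mem_insert.1 hc with rfl | hc <;>
          rcases Finset.mem_insert.1 hd with rfl | hd
        · exact absurd rfl hcd
        · exact hfar' d hd
        · rw [norm_sub_rev]; exact hfar' c hc
        · exact hsep c hc d hd hcd)
    rw [Finset.card_insert_of_notMem hx2] at hle
    omega

/-- Bounds on a `1/2`-net of the unit ball control the operator norm up to a factor `2`. -/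
lemma opNorm_le_of_half_net {E F : Type*} [NormedAddCommGroup E] [NormedSpace ℂ E]
    [NormedAddCommGroup F] [NormedSpace ℂ F] {s : Set E}
    (hs : ∀ x : E, ‖x‖ ≤ 1 → ∃ c ∈ s, ‖x - c‖ ≤ 1 / 2) (g : E →L[ℂ] F) {m : ℝ}
    (hm : ∀ y ∈ s, ‖g y‖ ≤ m) : ‖g‖ ≤ 2 * m := by
  obtain ⟨c₀, hc₀, -⟩ := hs 0 (by simp)
  have hm0 : 0 ≤ m := (norm_nonneg _).trans (hm _ hc₀)
  have : ‖g‖ ≤ m + ‖g‖ * (1 / 2) := by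
    refine g.opNorm_le_of_unit_norm (by positivity) fun x hx => ?_
    obtain ⟨c, hc, hxc⟩ := hs x hx.le
    calc ‖g x‖ = ‖g c + g (x - c)‖ := by rw [← map_add]; simp
      _ ≤ ‖g c‖ + ‖g (x - c)‖ := norm_add_le _ _
      _ ≤ m + ‖g‖ * (1 / 2) := add_le_add (hm c hc) (g.le_opNorm_of_le hxc)
  linarith

/-- Bounds of a sesquilinear form on a `1/2`-net control the operator norm up to a factor `4`. -/
lemma opNorm_le_of_half_net_inner {E : Type*} [NormedAddCommGroup E] [InnerProductSpace ℂ E]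
    [CompleteSpace E] {s : Set E} (hs : ∀ x : E, ‖x‖ ≤ 1 → ∃ c ∈ s, ‖x - c‖ ≤ 1 / 2)
    (f : E →L[ℂ] E) {m : ℝ} (hm : ∀ x ∈ s, ∀ y ∈ s, ‖inner ℂ x (f y)‖ ≤ m) :
    ‖f‖ ≤ 4 * m := by
  have h : ‖f.adjoint‖ ≤ 2 * (2 * m) := by
    refine opNorm_le_of_half_net hs _ fun x hx => ?_
    rw [← innerSL_apply_norm ℂ]
    refine opNorm_le_of_half_net hs _ fun y hy => ?_
    rw [innerSL_apply_apply, ContinuousLinearMap.adjoint_inner_left]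
    exact hm x hx y hy
  rw [LinearIsometryEquiv.norm_map] at h
  linarith

/-- The isometry group of a finite-dimensional inner product space is transitive on spheres. -/
lemma exists_linearIsometryEquiv_apply_eq {E : Type*} [NormedAddCommGroup E]
    [InnerProductSpace ℂ E] [FiniteDimensional ℂ E] {x v : E} (h : ‖x‖ = ‖v‖) :
    ∃ A : E ≃ₗᵢ[ℂ] E, A x = v := by
  rcases eq_or_ne x 0 with rfl | hx
  · refine ⟨LinearIsometryEquiv.refl ℂ E, ?_⟩
    simpa [eq_comm] using h
  have hx' : (‖x‖ : ℂ) ≠ 0 := by simpa using hx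
  have : Nontrivial E := ⟨x, 0, hx⟩
  have hpos : 0 < Module.finrank ℂ E := Module.finrank_pos
  let i₀ : Fin (Module.finrank ℂ E) := ⟨0, hpos⟩
  have key : ∀ w : E, ‖w‖ = ‖x‖ →
      ∃ b : OrthonormalBasis (Fin (Module.finrank ℂ E)) ℂ E, b i₀ = (‖x‖ : ℂ)⁻¹ • w := by
    intro w hw
    obtain ⟨b, hb⟩ := Orthonormal.exists_orthonormalBasis_extension_of_card_eq (𝕜 := ℂ) (E := E)
      (ι := Fin (Module.finrank ℂ E)) (by simp) (v := fun _ => (‖x‖ : ℂ)⁻¹ • w) (s := {i₀}) (by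
        rw [orthonormal_iff_ite]
        rintro ⟨i, rfl⟩ ⟨j, rfl⟩
        simp [inner_self_eq_norm_sq_to_K, norm_smul, hw, hx])
    exact ⟨b, hb _ rfl⟩
  obtain ⟨b, hb⟩ := key x rfl
  obtain ⟨b', hb'⟩ := key v h.symm
  refine ⟨b.equiv b' (Equiv.refl _), ?_⟩
  have e : b.equiv b' (Equiv.refl _) (b i₀) = b' i₀ := by simp
  rw [hb, hb', map_smul] at e
  exact smul_right_injective E (inv_ne_zero hx') e

lemma exists_unitaryGroup_inner {N : ℕ} {x v : EuclideanSpace ℂ (Fin N)} (h : ‖x‖ = ‖v‖) :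
    ∃ V : Matrix.unitaryGroup (Fin N) ℂ, ∀ w : EuclideanSpace ℂ (Fin N),
      inner ℂ x (Matrix.toEuclideanCLM (𝕜 := ℂ) (V : Matrix (Fin N) (Fin N) ℂ) w) =
        inner ℂ v w := by
  obtain ⟨A, hA⟩ := exists_linearIsometryEquiv_apply_eq h
  let u := Unitary.linearIsometryEquiv.symm A.symm
  refine ⟨⟨(Matrix.toEuclideanCLM (n := Fin N) (𝕜 := ℂ)).symm u, ?_⟩, fun w => ?_⟩
  · exact Unitary.map_mem (Matrix.toEuclideanCLM (n := Fin N) (𝕜 := ℂ)).symm u.2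
  · simp only [StarAlgEquiv.apply_symm_apply]
    rw [← hA, ← A.inner_map_map]
    simp [u]

/-- Gaussian linearization of the square: `exp (X² / 4)` as a Gaussian Laplace transform. -/
lemma integral_exp_mul_gaussianReal_half (X : ℝ) :
    ∫ t, Real.exp (X * t) ∂ProbabilityTheory.gaussianReal 0 (1 / 2) = Real.exp (X ^ 2 / 4) := by
  have := ProbabilityTheory.mgf_gaussianReal (p := ProbabilityTheory.gaussianReal 0 (1 / 2))
    (X := id) (μ := 0) (v := 1 / 2) (by simp) X
  rw [ProbabilityTheory.mgf] at this
  simp only [id] at this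
  rw [this]
  congr 1
  push_cast
  ring

lemma integrable_and_integral_exp_half_sq_le :
    Integrable (fun t : ℝ => Real.exp (t ^ 2 / 2)) (ProbabilityTheory.gaussianReal 0 (1 / 2)) ∧
    ∫ t, Real.exp (t ^ 2 / 2) ∂ProbabilityTheory.gaussianReal 0 (1 / 2) ≤ 2 := by
  have hd : ∀ t : ℝ, ProbabilityTheory.gaussianPDFReal 0 (1 / 2) t * Real.exp (t ^ 2 / 2) =
      (√Real.pi)⁻¹ * Real.exp (-(1 / 2) * t ^ 2) := fun t => by
    rw [ProbabilityTheory.gaussianPDFReal, mul_assoc, ← Real.exp_add]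
    congr 1
    · push_cast; ring_nf
    · congr 1; push_cast; ring
  have hI := (integrable_exp_neg_mul_sq (b := 1 / 2) (by norm_num)).const_mul (√Real.pi)⁻¹
  constructor
  · rw [ProbabilityTheory.gaussianReal_of_var_ne_zero _ (by norm_num),
      ProbabilityTheory.gaussianPDF_def,
      integrable_withDensity_iff_integrable_smul₀' (by fun_prop) (by simp)]
    refine hI.congr (ae_of_all _ fun t => ?_)
    simp only [smul_eq_mul]
    rw [ENNReal.toReal_ofReal (ProbabilityTheory.gaussianPDFReal_nonneg _ _ _), hd]
  · rw [ProbabilityTheory.integral_gaussianReal_eq_integral_smul (by norm_num)]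
    simp only [smul_eq_mul, hd]
    rw [integral_const_mul, integral_gaussian, ← Real.sqrt_inv, ← Real.sqrt_mul (by positivity),
      Real.sqrt_le_left (by norm_num)]
    have := Real.pi_pos
    field_simp
    norm_num

/-- The sign `±1` encoded by a Boolean. -/
def boolSign (b : Bool) : ℝ := if b then 1 else -1

/-- Rademacher sums are sub-Gaussian: exponential square moment. -/
lemma sum_exp_rademacher_sq_le {N : ℕ} (a : Fin N → ℝ) (ha : ∑ j, a j ^ 2 ≤ 1) :
    ∑ e : Fin N → Bool, Real.exp ((∑ j, boolSign (e j) * a j) ^ 2 / 4) ≤ 2 ^ N * 2 := by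
  have hprod : ∀ t : ℝ, ∑ e : Fin N → Bool, Real.exp ((∑ j, boolSign (e j) * a j) * t) ≤
      2 ^ N * Real.exp (t ^ 2 / 2) := fun t => by
    calc ∑ e : Fin N → Bool, Real.exp ((∑ j, boolSign (e j) * a j) * t)
        = ∏ j, ∑ b : Bool, Real.exp (boolSign b * a j * t) := by
          rw [Fintype.prod_sum]
          refine Finset.sum_congr rfl fun e _ => ?_
          rw [Finset.sum_mul, Real.exp_sum]
      _ = ∏ j, (2 * Real.cosh (a j * t)) := by
          refine Finset.prod_congr rfl fun j _ => ?_
          simp only [boolSign, Fintype.sum_bool, Real.cosh_eq]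
          simp only [if_true, Bool.false_eq_true, if_false, one_mul, neg_mul]
          ring
      _ ≤ ∏ j, (2 * Real.exp ((a j * t) ^ 2 / 2)) := by
          refine Finset.prod_le_prod (fun j _ => by positivity) fun j _ => ?_
          gcongr
          exact Real.cosh_le_exp_half_sq _
      _ = 2 ^ N * Real.exp ((∑ j, a j ^ 2) * (t ^ 2 / 2)) := by
          rw [Finset.prod_mul_distrib, ← Real.exp_sum, Finset.sum_mul]
          simp only [Finset.prod_const, Finset.card_univ, Fintype.card_fin]
          congr 2
          exact Finset.sum_congr rfl fun j _ => by ring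
      _ ≤ 2 ^ N * Real.exp (t ^ 2 / 2) := by
          gcongr
          exact mul_le_of_le_one_left (by positivity) ha
  simp only [← integral_exp_mul_gaussianReal_half]
  have hintU : ∀ X : ℝ, Integrable (fun t => Real.exp (X * t))
      (ProbabilityTheory.gaussianReal 0 (1 / 2)) :=
    fun X => ProbabilityTheory.integrable_exp_mul_gaussianReal X
  rw [← integral_finsetSum _ fun e _ => hintU _]
  calc _ ≤ ∫ t, 2 ^ N * Real.exp (t ^ 2 / 2) ∂ProbabilityTheory.gaussianReal 0 (1 / 2) :=
        integral_mono (integrable_finsetSum _ fun e _ => hintU _)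
          (integrable_and_integral_exp_half_sq_le.1.const_mul _) hprod
    _ ≤ 2 ^ N * 2 := by
        rw [integral_const_mul]
        gcongr
        exact integrable_and_integral_exp_half_sq_le.2

lemma sum_exp_rademacher_norm_sq_le {N : ℕ} (w : EuclideanSpace ℂ (Fin N)) (hw : ‖w‖ ≤ 1) :
    ∑ e : Fin N → Bool, Real.exp (‖∑ j, (boolSign (e j) : ℂ) * w j‖ ^ 2 / 8) ≤ 2 ^ N * 2 := by
  have hw2 : ∑ j, ((w j).re ^ 2 + (w j).im ^ 2) ≤ 1 := by
    have := EuclideanSpace.norm_sq_eq w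
    simp only [Complex.sq_norm, Complex.normSq_apply, ← sq] at this
    rw [← this]
    exact pow_le_one₀ (norm_nonneg _) hw
  rw [Finset.sum_add_distrib] at hw2
  have hre := sum_exp_rademacher_sq_le (fun j => (w j).re)
    (by linarith [Finset.sum_nonneg fun j (_ : j ∈ Finset.univ) => sq_nonneg (w j).im])
  have him := sum_exp_rademacher_sq_le (fun j => (w j).im)
    (by linarith [Finset.sum_nonneg fun j (_ : j ∈ Finset.univ) => sq_nonneg (w j).re])
  calc _ ≤ ∑ e : Fin N → Bool, (Real.exp ((∑ j, boolSign (e j) * (w j).re) ^ 2 / 4) +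
          Real.exp ((∑ j, boolSign (e j) * (w j).im) ^ 2 / 4)) / 2 := by
        refine Finset.sum_le_sum fun e _ => ?_
        rw [Complex.sq_norm, Complex.normSq_apply]
        simp only [Complex.re_sum, Complex.im_sum, Complex.re_ofReal_mul, Complex.im_ofReal_mul]
        generalize ∑ j, boolSign (e j) * (w j).re = X
        generalize ∑ j, boolSign (e j) * (w j).im = Y
        have h1 : (X * X + Y * Y) / 8 = X ^ 2 / 8 + Y ^ 2 / 8 := by ring
        have h2 : X ^ 2 / 4 = X ^ 2 / 8 + X ^ 2 / 8 := by ring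
        have h3 : Y ^ 2 / 4 = Y ^ 2 / 8 + Y ^ 2 / 8 := by ring
        rw [h1, h2, h3, Real.exp_add, Real.exp_add, Real.exp_add]
        nlinarith [sq_nonneg (Real.exp (X ^ 2 / 8) - Real.exp (Y ^ 2 / 8))]
    _ ≤ 2 ^ N * 2 := by
        rw [← Finset.sum_div, Finset.sum_add_distrib]
        linarith

lemma measurable_inner_toEuclideanCLM {N : ℕ} (x y : EuclideanSpace ℂ (Fin N)) :
    Measurable fun u : Fin N → Fin N → ℂ =>
      inner ℂ x (Matrix.toEuclideanCLM (𝕜 := ℂ) (Matrix.of u) y) := by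
  simp only [PiLp.inner_apply, Matrix.ofLp_toEuclideanCLM, Matrix.mulVec, dotProduct,
    Matrix.of_apply, RCLike.inner_apply]
  fun_prop

lemma norm_toEuclideanCLM_apply_of_mem_unitaryGroup {N : ℕ} {M : Matrix (Fin N) (Fin N) ℂ}
    (hM : M ∈ Matrix.unitaryGroup (Fin N) ℂ) (y : EuclideanSpace ℂ (Fin N)) :
    ‖Matrix.toEuclideanCLM (𝕜 := ℂ) M y‖ = ‖y‖ :=
  Unitary.norm_map ⟨_, Unitary.map_mem (Matrix.toEuclideanCLM (n := Fin N) (𝕜 := ℂ)) hM⟩ y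

/-- The vectors with coordinates `± ‖x‖ / √N` all lie in the unitary orbit of `x`; averaging over
them gives a uniform exponential moment. -/
lemma exists_unitary_sum_exp_le {N : ℕ} (hN : 0 < N) (x : EuclideanSpace ℂ (Fin N))
    (hx : ‖x‖ ≤ 1) :
    ∃ V : (Fin N → Bool) → Matrix.unitaryGroup (Fin N) ℂ,
      ∀ w : EuclideanSpace ℂ (Fin N), ‖w‖ ≤ 1 →
        ∑ e, Real.exp (N / 8 * ‖inner ℂ x (Matrix.toEuclideanCLM (𝕜 := ℂ)
          (V e : Matrix (Fin N) (Fin N) ℂ) w)‖ ^ 2) ≤ 2 ^ N * 2 := by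
  have hN' : (0 : ℝ) < N := by exact_mod_cast hN
  let v : (Fin N → Bool) → EuclideanSpace ℂ (Fin N) := fun e =>
    WithLp.toLp 2 fun j => ((‖x‖ / √N * boolSign (e j) : ℝ) : ℂ)
  have hsgn : ∀ b, boolSign b ^ 2 = 1 := fun b => by cases b <;> simp [boolSign]
  have hv : ∀ e, ‖x‖ = ‖v e‖ := fun e => by
    rw [← sq_eq_sq₀ (norm_nonneg _) (norm_nonneg _), EuclideanSpace.norm_sq_eq (v e)]
    simp only [v, Complex.norm_real, Real.norm_eq_abs, sq_abs, mul_pow, hsgn, div_pow,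
      Real.sq_sqrt hN'.le]
    simp
    field_simp
  choose V hV using fun e => exists_unitaryGroup_inner (hv e)
  refine ⟨V, fun w hw => le_trans (Finset.sum_le_sum fun e _ => ?_)
    (sum_exp_rademacher_norm_sq_le w hw)⟩
  rw [hV]
  have : inner ℂ (v e) w = ((‖x‖ / √N : ℝ) : ℂ) * ∑ j, (boolSign (e j) : ℂ) * w j := by
    simp only [v, PiLp.inner_apply, RCLike.inner_apply, Complex.conj_ofReal, Finset.mul_sum]
    refine Finset.sum_congr rfl fun j _ => ?_
    push_cast
    ring
  rw [this, norm_mul, mul_pow, Complex.norm_real, Real.norm_eq_abs, sq_abs, div_pow,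
    Real.sq_sqrt hN'.le]
  gcongr
  have h1 : ‖x‖ ^ 2 ≤ 1 := pow_le_one₀ (norm_nonneg _) hx
  calc (N : ℝ) / 8 * (‖x‖ ^ 2 / N * ‖∑ j, (boolSign (e j) : ℂ) * w j‖ ^ 2)
      = ‖x‖ ^ 2 * (‖∑ j, (boolSign (e j) : ℂ) * w j‖ ^ 2 / 8) := by field_simp
    _ ≤ _ := mul_le_of_le_one_left (by positivity) h1

/-- Exponential moment of the quadratic form of a Haar-distributed tuple at a pair of vectors. -/
lemma integrable_and_integral_exp_form_le {n N : ℕ} (hN : 0 < N)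
    {Ω : Type*} [MeasurableSpace Ω] (μ : Measure Ω) [IsProbabilityMeasure μ]
    (U : Ω → Fin n → Fin N → Fin N → ℂ)
    (hmeas : Measurable U)
    (hunit : ∀ᵐ ω ∂μ, ∀ i, Matrix.of (U ω i) ∈ Matrix.unitaryGroup (Fin N) ℂ)
    (hinv : ∀ V : Fin n → Matrix.unitaryGroup (Fin N) ℂ,
      Measure.map (fun ω => fun i j k =>
        ((V i : Matrix (Fin N) (Fin N) ℂ) * Matrix.of (U ω i)) j k) μ = Measure.map U μ)
    (x y : EuclideanSpace ℂ (Fin N)) (hx : ‖x‖ ≤ 1) (hy : ‖y‖ ≤ 1) :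
    Integrable (fun ω => Real.exp (N / 8 * ∑ i,
      ‖inner ℂ x (Matrix.toEuclideanCLM (𝕜 := ℂ) (Matrix.of (U ω i)) y)‖ ^ 2)) μ ∧
    ∫ ω, Real.exp (N / 8 * ∑ i,
      ‖inner ℂ x (Matrix.toEuclideanCLM (𝕜 := ℂ) (Matrix.of (U ω i)) y)‖ ^ 2) ∂μ ≤ 2 ^ n := by
  let φ : (Fin n → Fin N → Fin N → ℂ) → ℝ := fun u => Real.exp (N / 8 * ∑ i,
    ‖inner ℂ x (Matrix.toEuclideanCLM (𝕜 := ℂ) (Matrix.of (u i)) y)‖ ^ 2)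
  have hφ : Measurable φ := by
    have h : ∀ i : Fin n, Measurable fun u : Fin n → Fin N → Fin N → ℂ =>
        inner ℂ x (Matrix.toEuclideanCLM (𝕜 := ℂ) (Matrix.of (u i)) y) := fun i =>
      (measurable_inner_toEuclideanCLM x y).comp (measurable_pi_apply i)
    fun_prop
  obtain ⟨V, hV⟩ := exists_unitary_sum_exp_le hN x hx
  let W : (Fin n → Fin N → Bool) → Ω → Fin n → Fin N → Fin N → ℂ := fun e ω i j k =>
    ((V (e i) : Matrix (Fin N) (Fin N) ℂ) * Matrix.of (U ω i)) j k
  have hW : ∀ e, Measurable (W e) := fun e => by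
    simp only [W, Matrix.mul_apply, Matrix.of_apply]
    fun_prop
  have hintU : Integrable (φ ∘ U) μ := by
    refine Integrable.of_bound (hφ.comp hmeas).aestronglyMeasurable
      (Real.exp (N / 8 * ∑ _i : Fin n, 1)) ?_
    filter_upwards [hunit] with ω hω
    simp only [Function.comp, φ, Real.norm_eq_abs, Real.abs_exp]
    gcongr with i
    refine pow_le_one₀ (norm_nonneg _) ((norm_inner_le_norm _ _).trans ?_)
    rw [norm_toEuclideanCLM_apply_of_mem_unitaryGroup (hω i)]
    exact mul_le_one₀ hx (norm_nonneg _) hy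
  have hintW : ∀ e, Integrable (fun ω => φ (W e ω)) μ := fun e => by
    change Integrable (φ ∘ W e) μ
    rw [← integrable_map_measure hφ.aestronglyMeasurable (hW e).aemeasurable,
      hinv fun i => V (e i), integrable_map_measure hφ.aestronglyMeasurable hmeas.aemeasurable]
    exact hintU
  have hWU : ∀ e, ∫ ω, φ (W e ω) ∂μ = ∫ ω, φ (U ω) ∂μ := fun e => by
    rw [← integral_map (hW e).aemeasurable hφ.aestronglyMeasurable, hinv fun i => V (e i),
      integral_map hmeas.aemeasurable hφ.aestronglyMeasurable]
  refine ⟨hintU, ?_⟩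
  have hsum : ∫ ω, ∑ e, φ (W e ω) ∂μ ≤ ∫ _ω, (2 ^ N * 2 : ℝ) ^ n ∂μ := by
    refine integral_mono_ae (integrable_finsetSum _ fun e _ => hintW e) (integrable_const _) ?_
    filter_upwards [hunit] with ω hω
    have hfac : ∀ e, φ (W e ω) = ∏ i, Real.exp (N / 8 * ‖inner ℂ x
        (Matrix.toEuclideanCLM (𝕜 := ℂ) (V (e i) : Matrix (Fin N) (Fin N) ℂ)
          (Matrix.toEuclideanCLM (𝕜 := ℂ) (Matrix.of (U ω i)) y))‖ ^ 2) := fun e => by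
      simp only [φ, Finset.mul_sum, Real.exp_sum]
      refine Finset.prod_congr rfl fun i _ => ?_
      have : Matrix.of (W e ω i) = (V (e i) : Matrix (Fin N) (Fin N) ℂ) * Matrix.of (U ω i) := rfl
      rw [this, map_mul, mul_apply_eq_comp]
    simp only [hfac]
    rw [← Fintype.prod_sum fun i (e : Fin N → Bool) => Real.exp (N / 8 * ‖inner ℂ x
        (Matrix.toEuclideanCLM (𝕜 := ℂ) (V e : Matrix (Fin N) (Fin N) ℂ)
          (Matrix.toEuclideanCLM (𝕜 := ℂ) (Matrix.of (U ω i)) y))‖ ^ 2)]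
    refine (Finset.prod_le_prod (fun i _ => by positivity) fun i _ => hV _ ?_).trans (by simp)
    rwa [norm_toEuclideanCLM_apply_of_mem_unitaryGroup (hω i)]
  rw [integral_finsetSum _ fun e _ => hintW e] at hsum
  simp only [hWU] at hsum
  simp only [Finset.sum_const, Finset.card_univ, Fintype.card_pi, Fintype.card_bool,
    Finset.prod_const, Fintype.card_fin, nsmul_eq_mul, integral_const, probReal_univ, one_smul,
    mul_pow] at hsum
  push_cast at hsum
  exact le_of_mul_le_mul_left hsum (by positivity)

/-- Cauchy–Schwarz in the coefficients and a net for the two unit vectors. -/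
lemma matOpNorm_sum_smul_sq_le {n N : ℕ} {s : Set (EuclideanSpace ℂ (Fin N))}
    (hs : ∀ x : EuclideanSpace ℂ (Fin N), ‖x‖ ≤ 1 → ∃ c ∈ s, ‖x - c‖ ≤ 1 / 2)
    (M : Fin n → Matrix (Fin N) (Fin N) ℂ) {G : ℝ}
    (hG : ∀ x ∈ s, ∀ y ∈ s,
      ∑ i, ‖inner ℂ x (Matrix.toEuclideanCLM (𝕜 := ℂ) (M i) y)‖ ^ 2 ≤ G)
    (l : Fin n → ℂ) (hl : ∑ i, ‖l i‖ ^ 2 ≤ 1) :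
    matOpNorm (∑ i, l i • M i) ^ 2 ≤ 16 * G := by
  obtain ⟨c, hc, -⟩ := hs 0 (by simp)
  have hG0 : 0 ≤ G := (Finset.sum_nonneg fun i _ => by positivity).trans (hG c hc c hc)
  have h : matOpNorm (∑ i, l i • M i) ≤ 4 * √G := by
    refine opNorm_le_of_half_net_inner hs _ fun x hx y hy => Real.le_sqrt_of_sq_le ?_
    simp only [map_sum, map_smul, sum_apply, smul_apply,
      inner_sum, inner_smul_right]
    calc _ ≤ (∑ i, ‖l i‖ * ‖inner ℂ x (Matrix.toEuclideanCLM (𝕜 := ℂ) (M i) y)‖) ^ 2 := by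
          gcongr
          refine (norm_sum_le _ _).trans (le_of_eq ?_)
          simp only [norm_mul]
      _ ≤ (∑ i, ‖l i‖ ^ 2) *
            ∑ i, ‖inner ℂ x (Matrix.toEuclideanCLM (𝕜 := ℂ) (M i) y)‖ ^ 2 :=
          Finset.sum_mul_sq_le_sq_mul_sq _ _ _
      _ ≤ 1 * G := by
          gcongr
          exact hG x hx y hy
      _ = G := one_mul G
  calc _ ≤ (4 * √G) ^ 2 := by
        gcongr
        exact norm_nonneg _
    _ = 16 * G := by rw [mul_pow, Real.sq_sqrt hG0]; norm_num

/-- For `U₁,...,Uₙ` independent Haar-random `N×N` unitaries (formalized as an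
`n`-tuple-of-unitaries–valued random variable whose law is invariant under left translation
by any fixed tuple of unitaries, i.e. Haar distributed),
`E sup_{∑|λᵢ|²≤1} ‖∑ λᵢ Uᵢ‖ ≤ 32π(1 + √(n/(4N)))`. -/
theorem expectation_sup_norm_random_unitaries (n N : ℕ) (hN : 0 < N)
    {Ω : Type*} [MeasurableSpace Ω] (μ : Measure Ω) [IsProbabilityMeasure μ]
    (U : Ω → Fin n → Fin N → Fin N → ℂ)
    (hmeas : Measurable U)
    (hunit : ∀ᵐ ω ∂μ, ∀ i, Matrix.of (U ω i) ∈ Matrix.unitaryGroup (Fin N) ℂ)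
    (hinv : ∀ V : Fin n → Matrix.unitaryGroup (Fin N) ℂ,
      Measure.map (fun ω => fun i j k =>
        ((V i : Matrix (Fin N) (Fin N) ℂ) * Matrix.of (U ω i)) j k) μ = Measure.map U μ) :
    ∫ ω, (⨆ lam : {l : Fin n → ℂ // ∑ i, ‖l i‖ ^ 2 ≤ 1},
        matOpNorm (∑ i, lam.1 i • Matrix.of (U ω i))) ∂μ ≤
      32 * Real.pi * (1 + Real.sqrt (n / (4 * N))) := by
  have hN' : (0 : ℝ) < N := by exact_mod_cast hN
  obtain ⟨s, hcard, hs1, hs⟩ := exists_half_net (EuclideanSpace ℂ (Fin N))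
  rw [finrank_real_of_complex, finrank_euclideanSpace_fin] at hcard
  set A : ℝ := 32 * Real.pi * (1 + √(n / (4 * N))) with hA
  have hA0 : 0 < A := by positivity
  let S : EuclideanSpace ℂ (Fin N) × EuclideanSpace ℂ (Fin N) → Ω → ℝ := fun p ω =>
    ∑ i, ‖inner ℂ p.1 (Matrix.toEuclideanCLM (𝕜 := ℂ) (Matrix.of (U ω i)) p.2)‖ ^ 2
  let b : ℝ := 7 * N + n
  let G : Ω → ℝ := fun ω =>
    8 / N * (b - 1 + Real.exp (-b) * ∑ p ∈ s ×ˢ s, Real.exp (N / 8 * S p ω))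
  have hmom : ∀ p ∈ s ×ˢ s, Integrable (fun ω => Real.exp (N / 8 * S p ω)) μ ∧
      ∫ ω, Real.exp (N / 8 * S p ω) ∂μ ≤ 2 ^ n := fun p hp =>
    integrable_and_integral_exp_form_le hN μ U hmeas hunit hinv p.1 p.2
      (hs1 _ (Finset.mem_product.1 hp).1) (hs1 _ (Finset.mem_product.1 hp).2)
  have hSG : ∀ p ∈ s ×ˢ s, ∀ ω, S p ω ≤ G ω := fun p hp ω => by
    have h1 := Real.add_one_le_exp (N / 8 * S p ω - b)
    have h2 : Real.exp (N / 8 * S p ω - b) ≤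
        Real.exp (-b) * ∑ p ∈ s ×ˢ s, Real.exp (N / 8 * S p ω) := by
      rw [sub_eq_neg_add, Real.exp_add]
      gcongr
      exact Finset.single_le_sum (f := fun p => Real.exp (N / 8 * S p ω))
        (fun _ _ => (Real.exp_pos _).le) hp
    calc S p ω = 8 / N * (N / 8 * S p ω) := by field_simp
      _ ≤ G ω := by
        simp only [G]
        gcongr
        linarith
  have hsumint : Integrable (fun ω => ∑ p ∈ s ×ˢ s, Real.exp (N / 8 * S p ω)) μ :=
    integrable_finsetSum _ fun p hp => (hmom p hp).1
  have hGint : Integrable G μ := ((integrable_const _).add (hsumint.const_mul _)).const_mul _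
  have hGle : ∫ ω, G ω ∂μ ≤ 56 + 8 * (n / N) := by
    have h1 : ∫ ω, ∑ p ∈ s ×ˢ s, Real.exp (N / 8 * S p ω) ∂μ ≤ Real.exp b := by
      rw [integral_finsetSum _ fun p hp => (hmom p hp).1]
      have hcard' : (s.card : ℝ) ≤ 5 ^ (2 * N) := by exact_mod_cast hcard
      have he : (2.7 : ℝ) ≤ Real.exp 1 := by linarith [Real.exp_one_gt_d9]
      calc _ ≤ ∑ p ∈ s ×ˢ s, (2 : ℝ) ^ n := Finset.sum_le_sum fun p hp => (hmom p hp).2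
        _ = s.card * s.card * 2 ^ n := by simp [Finset.card_product]
        _ ≤ 5 ^ (2 * N) * 5 ^ (2 * N) * 2 ^ n := by gcongr
        _ = (625 : ℝ) ^ N * 2 ^ n := by rw [pow_mul, ← mul_pow]; norm_num
        _ ≤ (Real.exp 1 ^ 7) ^ N * Real.exp 1 ^ n := by
          gcongr
          · calc (625 : ℝ) ≤ 2.7 ^ 7 := by norm_num
              _ ≤ _ := by gcongr
          · linarith
        _ = Real.exp b := by
          rw [← pow_mul, ← Real.exp_nat_mul, ← Real.exp_nat_mul, ← Real.exp_add]
          simp [b]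
    simp only [G]
    rw [integral_const_mul, integral_add (integrable_const _) (hsumint.const_mul _),
      integral_const_mul, integral_const, probReal_univ, one_smul]
    calc _ ≤ 8 / N * (b - 1 + Real.exp (-b) * Real.exp b) := by gcongr
      _ = 56 + 8 * (n / N) := by
        rw [← Real.exp_add]
        simp [b]
        field_simp
        ring
  have hsup : ∀ ω, (⨆ lam : {l : Fin n → ℂ // ∑ i, ‖l i‖ ^ 2 ≤ 1},
      matOpNorm (∑ i, lam.1 i • Matrix.of (U ω i))) ≤ A / 2 + 8 / A * G ω := fun ω => by
    have : Nonempty {l : Fin n → ℂ // ∑ i, ‖l i‖ ^ 2 ≤ 1} := ⟨0, by simp⟩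
    refine ciSup_le fun lam => ?_
    have h := matOpNorm_sum_smul_sq_le (s := s) hs (fun i => Matrix.of (U ω i)) (G := G ω)
      (fun x hx y hy => hSG (x, y) (Finset.mem_product.2 ⟨hx, hy⟩) ω) lam.1 lam.2
    generalize matOpNorm (∑ i, lam.1 i • Matrix.of (U ω i)) = T at h ⊢
    rw [← sub_nonneg]
    have e : A / 2 + 8 / A * G ω - T = ((A - T) ^ 2 + (16 * G ω - T ^ 2)) / (2 * A) := by
      field_simp
      ring
    rw [e]
    have := sq_nonneg (A - T)
    exact div_nonneg (by linarith) (by positivity)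
  have hA2 : 16 * (56 + 8 * (n / N : ℝ)) ≤ A ^ 2 := by
    set r := √((n : ℝ) / (4 * N)) with hr
    have hr0 : 0 ≤ r := Real.sqrt_nonneg _
    have hr2 : r ^ 2 = n / N / 4 := by
      rw [hr, Real.sq_sqrt (by positivity)]
      field_simp
    have hpi : 96 * (1 + r) ≤ A := by
      rw [hA]
      gcongr
      linarith [Real.pi_gt_three]
    calc _ = 896 + 512 * r ^ 2 := by rw [hr2]; ring
      _ ≤ (96 * (1 + r)) ^ 2 := by nlinarith
      _ ≤ A ^ 2 := by gcongr
  calc _ ≤ ∫ ω, (A / 2 + 8 / A * G ω) ∂μ := by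
        refine integral_mono_of_nonneg (ae_of_all _ fun ω => Real.iSup_nonneg fun _ => norm_nonneg _)
          ((integrable_const _).add (hGint.const_mul _)) (ae_of_all _ hsup)
    _ = A / 2 + 8 / A * ∫ ω, G ω ∂μ := by
        rw [integral_add (integrable_const _) (hGint.const_mul _), integral_const_mul,
          integral_const, probReal_univ, one_smul]
    _ ≤ A / 2 + 8 / A * (A ^ 2 / 16) := by
        gcongr
        linarith
    _ = A := by
        field_simp
        ring
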